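/- The function g is holomorphic and injective on D, and g(D) equals the open rhombus R := {z ∈ ℂ : √3·|Re z| + |Im z| < √3} (the rhombus with vertices ±1 and ±i√3). Moreover g(0) = 0; g is real-valued and strictly increasing on the interval (−1,1) with g((−1,1)) = (−1,1); and g extends continuously to the points ±1, with lim_{z→1, z∈D} g(z) = 1 and lim_{z→−1, z∈D} g(z) = −1. -/

import Mathlib

open Complex Set Filter

/-- The Gauss hypergeometric function `₂F₁(p,q;r;z)` defined via the Euler integral
(principal branches of all complex powers). -/
noncomputable def hyp (p q r z : ℂ) : ℂ :=
  Complex.Gamma r / (Complex.Gamma q * Complex.Gamma (r - q)) *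
    ∫ t in (0:ℝ)..1, (t : ℂ) ^ (q - 1) * (1 - (t : ℂ)) ^ (r - q - 1) * (1 - (t : ℂ) * z) ^ (-p)

/-- The two slits `(-∞,-1] ∪ [1,+∞)` on the real axis, viewed inside `ℂ`. -/
def slit : Set ℂ := {z | z.im = 0 ∧ (z.re ≤ -1 ∨ 1 ≤ z.re)}

/-- The slit plane `D = ℂ ∖ ((-∞,-1] ∪ [1,+∞))`. -/
def Dslit : Set ℂ := slitᶜ

/-- `g(z) = (2√3·Γ(2/3)/(√π·Γ(1/6)))·z·₂F₁(1/2,2/3;3/2;z²)`. -/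
noncomputable def g (z : ℂ) : ℂ :=
  2 * (Real.sqrt 3 : ℂ) * Complex.Gamma (2/3) /
      ((Real.sqrt Real.pi : ℂ) * Complex.Gamma (1/6)) *
    z * hyp (1/2) (2/3) (3/2) (z ^ 2)

/-- The open rhombus with vertices `±1` and `±i√3`. -/
def rhombus : Set ℂ :=
  {z | Real.sqrt 3 * |z.re| + |z.im| < Real.sqrt 3}

/-- The Euler integral `∫₀¹ t^(b-1) (1-t)^(d-1) (1-tz)^(-c) dt`. -/
noncomputable def eulerIntegral (b d c z : ℂ) : ℂ :=
  ∫ t in (0:ℝ)..1, (t : ℂ) ^ (b - 1) * (1 - (t : ℂ)) ^ (d - 1) * (1 - (t : ℂ) * z) ^ (-c)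

theorem hyp_eq_eulerIntegral (p q r z : ℂ) :
    hyp p q r z = Gamma r / (Gamma q * Gamma (r - q)) * eulerIntegral q (r - q) p z := rfl

theorem one_sub_mul_mem_slitPlane {z : ℂ} (hz : 1 - z ∈ slitPlane) {t : ℝ}
    (ht : t ∈ Icc (0:ℝ) 1) : 1 - (t : ℂ) * z ∈ slitPlane := by
  have h := starConvex_one_slitPlane hz (a := 1 - t) (b := t) (by linarith [ht.2]) ht.1 (by ring)
  convert h using 1
  simp only [real_smul]
  push_cast
  ring

theorem isOpen_one_sub_mem_slitPlane : IsOpen {z : ℂ | 1 - z ∈ slitPlane} :=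
  isOpen_slitPlane.preimage (by fun_prop)

theorem continuousOn_one_sub_mul_cpow (c : ℂ) :
    ContinuousOn (fun x : ℝ × ℂ => (1 - (x.1 : ℂ) * x.2) ^ (-c))
      (Icc 0 1 ×ˢ {z : ℂ | 1 - z ∈ slitPlane}) := by
  intro x hx
  refine ContinuousAt.continuousWithinAt ?_
  refine ContinuousAt.cpow (by fun_prop) continuousAt_const ?_
  exact one_sub_mul_mem_slitPlane hx.2 hx.1

theorem exists_closedBall_norm_cpow_le {z₀ : ℂ} (hz : 1 - z₀ ∈ slitPlane) (c : ℂ) :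
    ∃ ε > 0, ∃ M : ℝ, Metric.closedBall z₀ ε ⊆ {z : ℂ | 1 - z ∈ slitPlane} ∧
      ∀ z ∈ Metric.closedBall z₀ ε, ∀ t ∈ Icc (0:ℝ) 1, ‖(1 - (t : ℂ) * z) ^ (-c)‖ ≤ M := by
  obtain ⟨ε, hε, hsub⟩ := Metric.nhds_basis_closedBall.mem_iff.1
    (isOpen_one_sub_mem_slitPlane.mem_nhds hz)
  obtain ⟨M, hM⟩ := (isCompact_Icc.prod (isCompact_closedBall z₀ ε)).exists_bound_of_continuousOn
    ((continuousOn_one_sub_mul_cpow c).mono (prod_mono le_rfl hsub))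
  exact ⟨ε, hε, M, hsub, fun z hz t ht => hM (t, z) ⟨ht, hz⟩⟩

theorem intervalIntegrable_eulerIntegrand {b d : ℂ} (hb : 0 < b.re) (hd : 0 < d.re) (c : ℂ) {z : ℂ}
    (hz : 1 - z ∈ slitPlane) :
    IntervalIntegrable (fun t : ℝ => (t : ℂ) ^ (b - 1) * (1 - (t : ℂ)) ^ (d - 1) *
      (1 - (t : ℂ) * z) ^ (-c)) MeasureTheory.volume 0 1 := by
  refine (betaIntegral_convergent hb hd).mul_continuousOn ?_
  rw [uIcc_of_le zero_le_one]
  exact (continuousOn_one_sub_mul_cpow c).comp (f := fun t : ℝ => (t, z)) (by fun_prop)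
    fun t ht => ⟨ht, hz⟩

theorem hasDerivAt_eulerIntegral {b d : ℂ} (hb : 0 < b.re) (hd : 0 < d.re) (c : ℂ) {z₀ : ℂ}
    (hz : 1 - z₀ ∈ slitPlane) :
    HasDerivAt (eulerIntegral b d c) (c * eulerIntegral (b + 1) d (c + 1) z₀) z₀ := by
  obtain ⟨ε, hε, M, hsub, hM⟩ := exists_closedBall_norm_cpow_le hz (c + 1)
  have hb' : 0 < (b + 1).re := by simp only [add_re, one_re]; linarith
  have hI := (intervalIntegrable_eulerIntegrand hb' hd (c + 1) hz).const_mul c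
  have key := intervalIntegral.hasDerivAt_integral_of_dominated_loc_of_deriv_le
    (F := fun z (t : ℝ) => (t : ℂ) ^ (b - 1) * (1 - (t : ℂ)) ^ (d - 1) * (1 - (t : ℂ) * z) ^ (-c))
    (F' := fun z (t : ℝ) => c * ((t : ℂ) ^ (b + 1 - 1) * (1 - (t : ℂ)) ^ (d - 1) *
      (1 - (t : ℂ) * z) ^ (-(c + 1))))
    (bound := fun t : ℝ => ‖c‖ * (‖(t : ℂ) ^ (b + 1 - 1) * (1 - (t : ℂ)) ^ (d - 1)‖ * M))
    (a := 0) (b := 1) (μ := MeasureTheory.volume) (x₀ := z₀)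
    (Metric.closedBall_mem_nhds z₀ hε) ?_ (intervalIntegrable_eulerIntegrand hb hd c hz)
    hI.def'.aestronglyMeasurable ?_ ?_ ?_
  · have h := key.2
    rw [intervalIntegral.integral_const_mul] at h
    exact h
  · filter_upwards [isOpen_one_sub_mem_slitPlane.mem_nhds hz] with z hz'
    exact (intervalIntegrable_eulerIntegrand hb hd c hz').def'.aestronglyMeasurable
  · refine MeasureTheory.ae_of_all _ fun t ht z hz' => ?_
    rw [uIoc_of_le zero_le_one] at ht
    rw [norm_mul, norm_mul (_ * _)]
    gcongr
    exact hM z hz' t ⟨ht.1.le, ht.2⟩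
  · exact (((betaIntegral_convergent hb' hd).norm).mul_const M).const_mul _
  · refine MeasureTheory.ae_of_all _ fun t ht z hz' => ?_
    rw [uIoc_of_le zero_le_one] at ht
    have ht0 : (t : ℂ) ≠ 0 := by exact_mod_cast ht.1.ne'
    have h1 : HasDerivAt (fun z : ℂ => 1 - (t : ℂ) * z) (-(t : ℂ)) z := by
      simpa using ((hasDerivAt_id z).const_mul (t : ℂ)).const_sub 1
    have h2 := (h1.cpow_const (c := -c)
      (one_sub_mul_mem_slitPlane (hsub hz') ⟨ht.1.le, ht.2⟩)).const_mul
      ((t : ℂ) ^ (b - 1) * (1 - (t : ℂ)) ^ (d - 1))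
    refine h2.congr_deriv ?_
    rw [show b + 1 - 1 = b - 1 + 1 by ring, cpow_add _ _ ht0, cpow_one,
      show -(c + 1) = -c - 1 by ring]
    ring

/-- Integrating the `t`-derivative of `t^b (1-t)^d (1-tz)^(-c)` with `c = b + d`. -/
theorem one_sub_mul_eulerIntegral {b d : ℂ} (hb : 0 < b.re) (hd : 0 < d.re) {z : ℂ}
    (hz : 1 - z ∈ slitPlane) :
    (b + d) * (1 - z) * eulerIntegral (b + 1) d (b + d + 1) z = b * eulerIntegral b d (b + d) z := by
  have hb0 : b ≠ 0 := by rintro rfl; simp at hb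
  have hd0 : d ≠ 0 := by rintro rfl; simp at hd
  have hb' : 0 < (b + 1).re := by simp only [add_re, one_re]; linarith
  have hI1 := (intervalIntegrable_eulerIntegrand hb hd (b + d) hz).const_mul b
  have hI2 := (intervalIntegrable_eulerIntegrand hb' hd (b + d + 1) hz).const_mul
    ((b + d) * (1 - z))
  have key := intervalIntegral.integral_eq_sub_of_hasDerivAt_of_le
    (f := fun t : ℝ => (t : ℂ) ^ b * (1 - (t : ℂ)) ^ d * (1 - (t : ℂ) * z) ^ (-(b + d)))
    zero_le_one ?_ ?_ (hI1.sub hI2)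
  · rw [intervalIntegral.integral_sub hI1 hI2, intervalIntegral.integral_const_mul,
      intervalIntegral.integral_const_mul] at key
    simp only [ofReal_one, ofReal_zero, sub_self, zero_cpow hb0, zero_cpow hd0, mul_zero,
      zero_mul] at key
    exact (sub_eq_zero.1 key).symm
  · refine ContinuousOn.mul (Continuous.continuousOn ?_) ?_
    · refine (continuous_ofReal_cpow_const hb).mul ?_
      have := (continuous_ofReal_cpow_const hd).comp (continuous_const.sub continuous_id :
        Continuous fun t : ℝ => 1 - t)
      simpa [Function.comp_def] using this
    · exact (continuousOn_one_sub_mul_cpow (b + d)).comp (f := fun t : ℝ => (t, z)) (by fun_prop)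
        fun t ht => ⟨ht, hz⟩
  · intro t ht
    have ht0 : (t : ℂ) ≠ 0 := by exact_mod_cast ht.1.ne'
    have ht1 : 1 - (t : ℂ) ≠ 0 := by
      rw [sub_ne_zero]; exact_mod_cast ht.2.ne'
    have hs := one_sub_mul_mem_slitPlane hz ⟨ht.1.le, ht.2.le⟩
    have hs0 := slitPlane_ne_zero hs
    have hs1 : 1 - (t : ℂ) ∈ slitPlane := by
      rw [show 1 - (t : ℂ) = ((1 - t : ℝ) : ℂ) by push_cast; rfl, ofReal_mem_slitPlane]
      linarith [ht.2]
    have hid : HasDerivAt (fun t : ℝ => (t : ℂ)) 1 t := ofRealCLM.hasDerivAt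
    have h1 := hasDerivAt_ofReal_cpow_const (x := t) ht.1.ne' hb0
    have h2 : HasDerivAt (fun t : ℝ => (1 - (t : ℂ)) ^ d) (d * (1 - (t : ℂ)) ^ (d - 1) * -1) t :=
      (((hasDerivAt_id (t : ℂ)).const_sub 1).cpow_const (c := d) hs1).comp_ofReal
    have h3 : HasDerivAt (fun t : ℝ => (1 - (t : ℂ) * z) ^ (-(b + d)))
        (-(b + d) * (1 - (t : ℂ) * z) ^ (-(b + d) - 1) * -(1 * z)) t :=
      ((((hasDerivAt_id (t : ℂ)).mul_const z).const_sub 1).cpow_const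
        (c := -(b + d)) hs).comp_ofReal
    refine ((h1.mul h2).mul h3).congr_deriv ?_
    dsimp only [Pi.mul_apply]
    rw [show b + 1 - 1 = b - 1 + 1 by ring, show (t : ℂ) ^ b = t ^ (b - 1 + 1) by ring_nf,
      cpow_add _ _ ht0, show (1 - (t : ℂ)) ^ d = (1 - (t : ℂ)) ^ (d - 1 + 1) by ring_nf,
      cpow_add _ _ ht1, show -(b + d) = -(b + d + 1) + 1 by ring, cpow_add _ _ hs0,
      show -(b + d + 1) + 1 - 1 = -(b + d + 1) by ring]
    simp only [cpow_one]
    ring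

theorem isPreconnected_one_sub_mem_slitPlane : IsPreconnected {z : ℂ | 1 - z ∈ slitPlane} := by
  have h := (starConvex_one_slitPlane.isPathConnected one_mem_slitPlane).isConnected.isPreconnected
  convert h.image (fun z => 1 - z) (by fun_prop) using 1
  ext z
  refine ⟨fun hz => ⟨1 - z, hz, by ring⟩, ?_⟩
  rintro ⟨w, hw, rfl⟩
  simpa using hw

theorem eulerIntegral_add {b d : ℂ} (hb : 0 < b.re) (hd : 0 < d.re) {z : ℂ}
    (hz : 1 - z ∈ slitPlane) :
    eulerIntegral b d (b + d) z = betaIntegral b d * (1 - z) ^ (-b) := by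
  have hder : ∀ z : ℂ, 1 - z ∈ slitPlane →
      HasDerivAt (fun z => eulerIntegral b d (b + d) z * (1 - z) ^ b) 0 z := by
    intro z hz
    have h0 := slitPlane_ne_zero hz
    have h1 := (hasDerivAt_eulerIntegral hb hd (b + d) hz).mul
      (((hasDerivAt_id z).const_sub 1).cpow_const (c := b) hz)
    refine h1.congr_deriv ?_
    have h2 := one_sub_mul_eulerIntegral hb hd hz
    simp only [id]
    rw [show (1 - z) ^ b = (1 - z) ^ (b - 1 + 1) by ring_nf, cpow_add _ _ h0, cpow_one]
    linear_combination ((1 - z) ^ (b - 1)) * h2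
  have h := isOpen_one_sub_mem_slitPlane.is_const_of_deriv_eq_zero
    isPreconnected_one_sub_mem_slitPlane
    (fun z hz => (hder z hz).differentiableAt.differentiableWithinAt)
    (fun z hz => (hder z hz).deriv) hz (y := 0) (by simp)
  have h0 : eulerIntegral b d (b + d) 0 = betaIntegral b d := by
    simp [eulerIntegral, betaIntegral]
  have hz0 := slitPlane_ne_zero hz
  rw [h0] at h
  simp only [sub_zero, one_cpow, mul_one] at h
  rw [← h, mul_assoc, ← cpow_add _ _ hz0, add_neg_cancel, cpow_zero, mul_one]

theorem eulerIntegral_add_mul {b d : ℂ} (hb : 0 < b.re) (hd : 0 < d.re) (c : ℂ) {z : ℂ}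
    (hz : 1 - z ∈ slitPlane) :
    eulerIntegral b d c z + z * eulerIntegral (b + 1) d (c + 1) z = eulerIntegral b d (c + 1) z := by
  have hb' : 0 < (b + 1).re := by simp only [add_re, one_re]; linarith
  have hI1 := intervalIntegrable_eulerIntegrand hb hd c hz
  have hI2 := (intervalIntegrable_eulerIntegrand hb' hd (c + 1) hz).const_mul z
  unfold eulerIntegral
  rw [← intervalIntegral.integral_const_mul, ← intervalIntegral.integral_add hI1 hI2]
  refine intervalIntegral.integral_congr_ae (MeasureTheory.ae_of_all _ fun t ht => ?_)
  rw [uIoc_of_le zero_le_one] at ht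
  have ht0 : (t : ℂ) ≠ 0 := by exact_mod_cast ht.1.ne'
  have hs0 := slitPlane_ne_zero (one_sub_mul_mem_slitPlane hz ⟨ht.1.le, ht.2⟩)
  rw [show b + 1 - 1 = b - 1 + 1 by ring, cpow_add _ _ ht0, show -c = -(c + 1) + 1 by ring,
    cpow_add _ _ hs0]
  simp only [cpow_one]
  ring

theorem one_sub_sq_mem_slitPlane {z : ℂ} (hz : z ∈ Dslit) : 1 - z ^ 2 ∈ slitPlane := by
  rw [mem_slitPlane_iff]
  by_contra! h
  obtain ⟨h1, h2⟩ := h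
  simp only [sub_re, one_re, sub_im, one_im, sq, mul_re, mul_im] at h1 h2
  have hx : z.re * z.im = 0 := by linarith
  have him : z.im = 0 := by
    rcases mul_eq_zero.1 hx with h | h
    · rw [h] at h1
      nlinarith [sq_nonneg z.im]
    · exact h
  refine hz ⟨him, ?_⟩
  rw [him] at h1
  by_contra! h
  nlinarith [h.1, h.2]

/-- The normalising constant in the definition of `g`. -/
noncomputable def gConst : ℝ :=
  2 * Real.sqrt 3 * Real.Gamma (2 / 3) / (Real.sqrt Real.pi * Real.Gamma (1 / 6))

theorem gConst_pos : 0 < gConst := by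
  have h1 : 0 < Real.Gamma (2 / 3) := Real.Gamma_pos_of_pos (by norm_num)
  have h2 : 0 < Real.Gamma (1 / 6) := Real.Gamma_pos_of_pos (by norm_num)
  have h3 := Real.pi_pos
  unfold gConst
  positivity

theorem ofReal_gConst : (gConst : ℂ) = 2 * (Real.sqrt 3 : ℂ) * Complex.Gamma (2/3) /
    ((Real.sqrt Real.pi : ℂ) * Complex.Gamma (1/6)) := by
  rw [show (2 / 3 : ℂ) = ((2 / 3 : ℝ) : ℂ) by push_cast; rfl,
    show (1 / 6 : ℂ) = ((1 / 6 : ℝ) : ℂ) by push_cast; rfl, Complex.Gamma_ofReal,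
    Complex.Gamma_ofReal]
  simp only [gConst]
  push_cast
  ring

theorem g_eq (z : ℂ) : g z = gConst * z * (Gamma (3 / 2) / (Gamma (2 / 3) * Gamma (3 / 2 - 2 / 3)) *
    eulerIntegral (2 / 3) (3 / 2 - 2 / 3) (1 / 2) (z ^ 2)) := by
  rw [ofReal_gConst, g, hyp_eq_eulerIntegral]

theorem g_neg (z : ℂ) : g (-z) = -g z := by
  simp only [g_eq, neg_sq]; ring

theorem g_zero : g 0 = 0 := by simp [g]

theorem hasDerivAt_g {z : ℂ} (hz : z ∈ Dslit) :
    HasDerivAt g (gConst * (1 - z ^ 2) ^ (-(2 / 3) : ℂ)) z := by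
  have hs := one_sub_sq_mem_slitPlane hz
  have hb : 0 < (2 / 3 : ℂ).re := by norm_num
  have hd : 0 < (3 / 2 - 2 / 3 : ℂ).re := by norm_num
  have h1 : HasDerivAt (fun z : ℂ => z ^ 2) (2 * z) z := by simpa using hasDerivAt_pow 2 z
  have h2 : HasDerivAt (fun z => eulerIntegral (2 / 3) (3 / 2 - 2 / 3) (1 / 2) (z ^ 2)) _ z :=
    HasDerivAt.comp z (hasDerivAt_eulerIntegral hb hd (1 / 2) hs) h1
  have h3 := ((hasDerivAt_id z).const_mul (gConst : ℂ)).mul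
    (h2.const_mul (Gamma (3 / 2) / (Gamma (2 / 3) * Gamma (3 / 2 - 2 / 3))))
  have hG := Gamma_mul_Gamma_eq_betaIntegral hb hd
  have hG1 := Gamma_ne_zero_of_re_pos hb
  have hG2 := Gamma_ne_zero_of_re_pos hd
  have h4 := eulerIntegral_add_mul hb hd (1 / 2) hs
  rw [show (1 / 2 + 1 : ℂ) = 2 / 3 + (3 / 2 - 2 / 3) by norm_num, eulerIntegral_add hb hd hs] at h4
  refine (h3.congr_deriv ?_).congr_of_eventuallyEq (Filter.Eventually.of_forall fun z => g_eq z)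
  rw [show (1 / 2 + 1 : ℂ) = 2 / 3 + (3 / 2 - 2 / 3) by norm_num]
  rw [show (2 / 3 + (3 / 2 - 2 / 3) : ℂ) = 3 / 2 by norm_num] at *
  simp only [id]
  trans gConst * (Gamma (3 / 2) / (Gamma (2 / 3) * Gamma (3 / 2 - 2 / 3)) *
    (betaIntegral (2 / 3) (3 / 2 - 2 / 3) * (1 - z ^ 2) ^ (-(2 / 3) : ℂ)))
  · rw [← h4]; ring
  · rw [← mul_assoc (_ / _), div_mul_eq_mul_div, ← hG, div_self (mul_ne_zero hG1 hG2), one_mul]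

theorem isOpen_Dslit : IsOpen Dslit := by
  have h1 : IsClosed {z : ℂ | z.im = 0} := isClosed_eq continuous_im continuous_const
  have h2 : IsClosed {z : ℂ | z.re ≤ -1 ∨ 1 ≤ z.re} :=
    (isClosed_le continuous_re continuous_const).union (isClosed_le continuous_const continuous_re)
  exact (h1.inter h2).isOpen_compl

theorem mem_Dslit_of_im_ne_zero {z : ℂ} (hz : z.im ≠ 0) : z ∈ Dslit := fun h => hz h.1

theorem mem_Dslit_of_abs_re_lt {z : ℂ} (h1 : -1 < z.re) (h2 : z.re < 1) : z ∈ Dslit :=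
  fun h => h.2.elim (fun h => by linarith) (fun h => by linarith)

theorem starConvex_Dslit : StarConvex ℝ 0 Dslit := by
  rw [starConvex_zero_iff]
  intro z hz t ht0 ht1 hs
  rcases ht0.eq_or_lt with rfl | ht
  · norm_num [slit] at hs
  simp only [slit, mem_ofPred_eq, smul_re, smul_im, smul_eq_mul, mul_eq_zero] at hs
  refine hz ⟨hs.1.resolve_left ht.ne', ?_⟩
  rcases hs.2 with h | h
  · left; nlinarith
  · right; nlinarith

open scoped ComplexConjugate in
theorem g_conj {z : ℂ} (hz : z ∈ Dslit) : g (conj z) = conj (g z) := by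
  have hmem : ∀ z ∈ Dslit, conj z ∈ Dslit := by
    intro z hz h
    exact hz ⟨by simpa using h.1, by simpa using h.2⟩
  have hder : ∀ z ∈ Dslit, HasDerivAt (fun z => g z - conj (g (conj z))) 0 z := by
    intro z hz
    have h1 := (hasDerivAt_g (hmem z hz)).conj_conj
    rw [conj_conj] at h1
    refine ((hasDerivAt_g hz).sub h1).congr_deriv ?_
    have h3 := conj_cpow (1 - z ^ 2) (-(2 / 3))
      (mem_slitPlane_iff_arg.1 (one_sub_sq_mem_slitPlane hz)).1
    have h4 : conj (-(2 / 3) : ℂ) = -(2 / 3) := by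
      simp [map_ofNat]
    simp only [map_sub, map_one, map_pow, h4] at h3
    rw [h3]
    simp
  have h := isOpen_Dslit.is_const_of_deriv_eq_zero
    (starConvex_Dslit.isPathConnected (mem_Dslit_of_abs_re_lt (by simp)
      (by simp))).isConnected.isPreconnected
    (fun z hz => (hder z hz).differentiableAt.differentiableWithinAt)
    (fun z hz => (hder z hz).deriv) (hmem z hz)
    (mem_Dslit_of_abs_re_lt (z := 0) (by simp) (by simp))
  simp only [conj_conj, map_zero, g_zero, sub_zero] at h
  exact sub_eq_zero.1 h

theorem g_ofReal_im {x : ℝ} (hx : x ∈ Ioo (-1 : ℝ) 1) : (g x).im = 0 := by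
  have h := g_conj (mem_Dslit_of_abs_re_lt (z := (x : ℂ)) (by simpa using hx.1) (by simpa using hx.2))
  rw [conj_ofReal] at h
  exact conj_eq_iff_im.1 h.symm

theorem tendsto_eulerIntegral_one {b d : ℂ} {c : ℝ} (hb : 0 < b.re) (hc : 0 ≤ c)
    (hd : c < d.re) :
    Tendsto (fun x : ℝ => eulerIntegral b d c x) (nhdsWithin 1 (Iio 1))
      (nhds (betaIntegral b (d - c))) := by
  have hdc : 0 < (d - c).re := by simpa using hd
  have hd' : 0 < d.re := hc.trans_lt hd
  have hbound : ∀ {t : ℝ}, t ∈ Ioo (0:ℝ) 1 →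
      (1 - (t : ℂ)) ^ (d - c - 1) = (1 - (t : ℂ)) ^ (d - 1) * (1 - (t : ℂ)) ^ (-c : ℂ) := by
    intro t ht
    have ht1 : 1 - (t : ℂ) ≠ 0 := by
      rw [sub_ne_zero]; exact_mod_cast ht.2.ne'
    rw [← cpow_add _ _ ht1]
    ring_nf
  have hae : ∀ {p : ℝ → Prop}, (∀ t ∈ Ioo (0:ℝ) 1, p t) →
      ∀ᵐ t : ℝ, t ∈ uIoc (0:ℝ) 1 → p t := by
    intro p hp
    have h1 : ∀ᵐ t : ℝ, t ≠ 1 := by simp [MeasureTheory.ae_iff]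
    filter_upwards [h1] with t ht1 ht
    rw [uIoc_of_le zero_le_one] at ht
    exact hp t ⟨ht.1, lt_of_le_of_ne ht.2 ht1⟩
  have hslit : ∀ {x : ℝ}, x < 1 → 1 - (x : ℂ) ∈ slitPlane := by
    intro x hx
    rw [show 1 - (x : ℂ) = ((1 - x : ℝ) : ℂ) by push_cast; rfl, ofReal_mem_slitPlane]
    linarith
  refine intervalIntegral.tendsto_integral_filter_of_dominated_convergence
    (fun t : ℝ => ‖(t : ℂ) ^ (b - 1) * (1 - (t : ℂ)) ^ (d - c - 1)‖) ?_ ?_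
    (betaIntegral_convergent hb hdc).norm (hae fun t ht => ?_)
  · filter_upwards [self_mem_nhdsWithin] with x hx
    exact (intervalIntegrable_eulerIntegrand hb hd' c (hslit hx)).def'.aestronglyMeasurable
  · filter_upwards [Ioo_mem_nhdsLT zero_lt_one] with x hx
    refine hae fun t ht => ?_
    rw [hbound ht, ← mul_assoc, norm_mul, norm_mul _ ((1 - (t : ℂ)) ^ (-c : ℂ))]
    have hpos : 0 < 1 - t := by linarith [ht.2]
    have hle : 1 - t ≤ 1 - t * x := by nlinarith [ht.1, hx.2]
    have e1 : (1 - (t : ℂ)) = ((1 - t : ℝ) : ℂ) := by push_cast; rfl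
    have e2 : (1 - (t : ℂ) * x) = ((1 - t * x : ℝ) : ℂ) := by push_cast; rfl
    have e3 : (-c : ℂ) = ((-c : ℝ) : ℂ) := by push_cast; rfl
    gcongr
    rw [e1, e2, e3, norm_cpow_eq_rpow_re_of_pos hpos,
      norm_cpow_eq_rpow_re_of_pos (hpos.trans_le hle), ofReal_re]
    exact Real.rpow_le_rpow_of_nonpos hpos hle (by linarith)
  · rw [hbound ht, ← mul_assoc]
    refine Tendsto.const_mul _ ?_
    have hcont : ContinuousAt (fun x : ℝ => (1 - (t : ℂ) * x) ^ (-c : ℂ)) 1 := by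
      refine ContinuousAt.cpow (by fun_prop) continuousAt_const ?_
      simpa using hslit ht.2
    have h := hcont.tendsto
    simp only [ofReal_one, mul_one] at h
    exact h.mono_left nhdsWithin_le_nhds

theorem gConst_mul_beta :
    (gConst : ℂ) * (Gamma (3 / 2) / (Gamma (2 / 3) * Gamma (3 / 2 - 2 / 3)) *
      betaIntegral (2 / 3) (3 / 2 - 2 / 3 - (1 / 2 : ℝ))) = 1 := by
  have hB := Gamma_mul_Gamma_eq_betaIntegral (s := 2 / 3) (t := 1 / 3) (by norm_num) (by norm_num)
  have h1 := Gamma_mul_Gamma_one_sub (1 / 3)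
  have h2 := Gamma_mul_Gamma_one_sub (1 / 6)
  have h3 : Gamma (3 / 2) = (Real.sqrt Real.pi : ℂ) / 2 := by
    rw [show (3 / 2 : ℂ) = ((3 / 2 : ℝ) : ℂ) by push_cast; rfl, Gamma_ofReal,
      show (3 / 2 : ℝ) = 1 / 2 + 1 by norm_num, Real.Gamma_add_one (by norm_num),
      Real.Gamma_one_half_eq]
    push_cast
    ring
  have s1 : sin (Real.pi * (1 / 3)) = (Real.sqrt 3 : ℂ) / 2 := by
    have := Real.sin_pi_div_three
    rw [show (Real.pi * (1 / 3) : ℂ) = ((Real.pi / 3 : ℝ) : ℂ) by push_cast; ring, ← ofReal_sin,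
      this]
    push_cast; rfl
  have s2 : sin (Real.pi * (1 / 6)) = (1 : ℂ) / 2 := by
    have := Real.sin_pi_div_six
    rw [show (Real.pi * (1 / 6) : ℂ) = ((Real.pi / 6 : ℝ) : ℂ) by push_cast; ring, ← ofReal_sin,
      this]
    push_cast; rfl
  rw [s1, show (1 - 1 / 3 : ℂ) = 2 / 3 by norm_num] at h1
  rw [s2, show (1 - 1 / 6 : ℂ) = 5 / 6 by norm_num] at h2
  rw [show (2 / 3 + 1 / 3 : ℂ) = 1 by norm_num, Gamma_one, one_mul] at hB
  rw [show (3 / 2 - 2 / 3 - (1 / 2 : ℝ) : ℂ) = 1 / 3 by push_cast; norm_num,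
    show (3 / 2 - 2 / 3 : ℂ) = 5 / 6 by norm_num, ← hB, h3, ofReal_gConst]
  have n1 : Gamma (2 / 3) ≠ 0 := Gamma_ne_zero_of_re_pos (by norm_num)
  have n2 : Gamma (1 / 6) ≠ 0 := Gamma_ne_zero_of_re_pos (by norm_num)
  have n3 : Gamma (5 / 6) ≠ 0 := Gamma_ne_zero_of_re_pos (by norm_num)
  have npi : (Real.pi : ℂ) ≠ 0 := by exact_mod_cast Real.pi_ne_zero
  have n4 : (Real.sqrt Real.pi : ℂ) ≠ 0 := by
    exact_mod_cast (Real.sqrt_pos.2 Real.pi_pos).ne'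
  have n5 : (Real.sqrt 3 : ℂ) ≠ 0 := by
    exact_mod_cast (Real.sqrt_pos.2 (by norm_num : (0:ℝ) < 3)).ne'
  field_simp at h1 h2 ⊢
  linear_combination h1 - h2

theorem tendsto_g_ofReal_one :
    Tendsto (fun x : ℝ => g x) (nhdsWithin 1 (Iio 1)) (nhds 1) := by
  have h1 := tendsto_eulerIntegral_one (b := 2 / 3) (d := 3 / 2 - 2 / 3) (c := 1 / 2)
    (by norm_num) (by norm_num) (by norm_num)
  have h2 : Tendsto (fun x : ℝ => x ^ 2) (nhdsWithin 1 (Iio 1)) (nhdsWithin 1 (Iio 1)) := by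
    refine tendsto_nhdsWithin_iff.2 ⟨?_, ?_⟩
    · have : Tendsto (fun x : ℝ => x ^ 2) (nhds 1) (nhds (1 ^ 2)) :=
        (continuous_pow 2).tendsto 1
      rw [one_pow] at this
      exact this.mono_left nhdsWithin_le_nhds
    · filter_upwards [Ioo_mem_nhdsLT zero_lt_one] with x hx
      simp only [mem_Iio]
      nlinarith [hx.1, hx.2]
  have h3 : Tendsto (fun x : ℝ => (gConst : ℂ) * (x : ℂ)) (nhdsWithin 1 (Iio 1))
      (nhds (gConst * (1 : ℝ))) := by
    refine Tendsto.mono_left ?_ nhdsWithin_le_nhds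
    exact (by fun_prop : Continuous fun x : ℝ => (gConst : ℂ) * (x : ℂ)).tendsto 1
  have h := h3.mul ((h1.comp h2).const_mul (Gamma (3 / 2) / (Gamma (2 / 3) * Gamma (3 / 2 - 2 / 3))))
  rw [ofReal_one, mul_one, gConst_mul_beta] at h
  refine h.congr fun x => ?_
  simp [g_eq]

/-- Near `1` the map `g` is Lipschitz in the local parameter `(1 - z)^(1/3)`. -/
theorem norm_g_one_sub_cube_sub_le {ζ η : ℂ} (hζ : ‖ζ‖ < 2 * ζ.re) (hζ1 : ‖ζ‖ < 1)
    (hη : ‖η‖ < 2 * η.re) (hη1 : ‖η‖ < 1) :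
    ‖g (1 - ζ ^ 3) - g (1 - η ^ 3)‖ ≤ 3 * gConst * ‖ζ - η‖ := by
  have hconv : Convex ℝ {ζ : ℂ | ‖ζ‖ < 2 * ζ.re ∧ ‖ζ‖ < 1} := by
    intro x hx y hy a b ha hb hab
    have hn : ‖a • x + b • y‖ ≤ a * ‖x‖ + b * ‖y‖ := by
      refine (norm_add_le _ _).trans ?_
      rw [norm_smul, norm_smul, Real.norm_of_nonneg ha, Real.norm_of_nonneg hb]
    obtain ⟨hx1, hx2⟩ := hx
    obtain ⟨hy1, hy2⟩ := hy
    simp only [mem_ofPred_eq, add_re, smul_re, smul_eq_mul]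
    rcases ha.eq_or_lt with rfl | ha
    · obtain rfl : b = 1 := by linarith
      simp at hn ⊢
      exact ⟨hy1, hy2⟩
    · constructor <;> refine hn.trans_lt ?_ <;> nlinarith
  have hder : ∀ ζ ∈ {ζ : ℂ | ‖ζ‖ < 2 * ζ.re ∧ ‖ζ‖ < 1}, HasDerivWithinAt (fun ζ => g (1 - ζ ^ 3))
      (gConst * (1 - (1 - ζ ^ 3) ^ 2) ^ (-(2 / 3) : ℂ) * (-(3 * ζ ^ 2)))
      {ζ : ℂ | ‖ζ‖ < 2 * ζ.re ∧ ‖ζ‖ < 1} ζ := by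
    rintro ζ ⟨h1, h2⟩
    have h3 : ‖ζ ^ 3‖ < 1 := by
      rw [norm_pow]; exact pow_lt_one₀ (norm_nonneg _) h2 (by norm_num)
    have h4 : |(ζ ^ 3).re| < 1 := (abs_re_le_norm _).trans_lt h3
    have hre : 0 < ζ.re := by linarith [norm_nonneg ζ]
    have hsq : ζ.re ^ 2 + ζ.im ^ 2 < 4 * ζ.re ^ 2 := by
      have := norm_nonneg ζ
      have e := Complex.sq_norm ζ
      rw [normSq_apply] at e
      nlinarith
    have hD : 1 - ζ ^ 3 ∈ Dslit := by
      rintro ⟨hi, hr⟩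
      have e1 : (ζ ^ 3).im = ζ.im * (3 * ζ.re ^ 2 - ζ.im ^ 2) := by
        simp only [pow_succ, pow_zero, one_mul, mul_im, mul_re]; ring
      have e2 : (ζ ^ 3).re = ζ.re * (ζ.re ^ 2 - 3 * ζ.im ^ 2) := by
        simp only [pow_succ, pow_zero, one_mul, mul_im, mul_re]; ring
      simp only [sub_im, one_im, sub_re, one_re] at hi hr
      have hi0 : ζ.im = 0 := by
        have : ζ.im * (3 * ζ.re ^ 2 - ζ.im ^ 2) = 0 := by linarith
        exact (mul_eq_zero.1 this).resolve_right (by nlinarith)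
      rw [hi0] at e2
      have : 0 < (ζ ^ 3).re := by rw [e2]; ring_nf; positivity
      rcases hr with hr | hr
      · linarith [(abs_lt.1 h4).2]
      · linarith
    have h5 : HasDerivAt (fun ζ : ℂ => 1 - ζ ^ 3) (-(3 * ζ ^ 2)) ζ := by
      simpa using (hasDerivAt_pow 3 ζ).const_sub 1
    exact ((hasDerivAt_g hD).comp ζ h5).hasDerivWithinAt
  refine Convex.norm_image_sub_le_of_norm_hasDerivWithin_le hder ?_ hconv ⟨hη, hη1⟩ ⟨hζ, hζ1⟩
  rintro ζ ⟨h1, h2⟩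
  have hζ0 : 0 < ‖ζ‖ := by
    refine norm_pos_iff.2 ?_
    rintro rfl
    simp at h1
  have h3 : ‖ζ ^ 3‖ < 1 := by
    rw [norm_pow]; exact pow_lt_one₀ (norm_nonneg _) h2 (by norm_num)
  have h4 : 1 ≤ ‖2 - ζ ^ 3‖ := by
    have := norm_sub_norm_le (2 : ℂ) (ζ ^ 3)
    norm_num at this h3
    linarith
  have e : (-(2 / 3) : ℂ) = ((-(2 / 3) : ℝ) : ℂ) := by push_cast; rfl
  rw [show 1 - (1 - ζ ^ 3) ^ 2 = ζ ^ 3 * (2 - ζ ^ 3) by ring, norm_mul, norm_mul, e, norm_cpow_real,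
    norm_mul, norm_real, Real.norm_of_nonneg gConst_pos.le, norm_neg, norm_mul, norm_pow, norm_pow,
    Real.mul_rpow (by positivity) (by positivity), ← Real.rpow_natCast_mul (by positivity)]
  have h6 : ‖2 - ζ ^ 3‖ ^ (-(2 / 3) : ℝ) ≤ 1 :=
    Real.rpow_le_one_of_one_le_of_nonpos h4 (by norm_num)
  have h7 : ‖ζ‖ ^ (((3 : ℕ) : ℝ) * (-(2 / 3))) * ‖ζ‖ ^ 2 = 1 := by
    rw [← Real.rpow_natCast, ← Real.rpow_add hζ0]
    norm_num
  have h8 := gConst_pos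
  have h9 : ‖(3 : ℂ)‖ = 3 := by norm_num
  rw [h9]
  calc gConst * (‖ζ‖ ^ (((3 : ℕ) : ℝ) * (-(2 / 3))) * ‖2 - ζ ^ 3‖ ^ (-(2 / 3) : ℝ)) * (3 * ‖ζ‖ ^ 2)
      = 3 * gConst * (‖ζ‖ ^ (((3 : ℕ) : ℝ) * (-(2 / 3))) * ‖ζ‖ ^ 2) *
        ‖2 - ζ ^ 3‖ ^ (-(2 / 3) : ℝ) := by ring
    _ ≤ 3 * gConst := by
      rw [h7, mul_one]
      exact mul_le_of_le_one_right (by positivity) h6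

theorem norm_g_one_sub_cube_sub_one_le {ζ : ℂ} (hζ : ‖ζ‖ < 2 * ζ.re) (hζ1 : ‖ζ‖ < 1) :
    ‖g (1 - ζ ^ 3) - 1‖ ≤ 3 * gConst * ‖ζ‖ := by
  have h1 : Tendsto (fun s : ℝ => 1 - s ^ 3) (nhdsWithin 0 (Ioi 0)) (nhdsWithin 1 (Iio 1)) := by
    refine tendsto_nhdsWithin_iff.2 ⟨?_, ?_⟩
    · refine Tendsto.mono_left ?_ nhdsWithin_le_nhds
      simpa using (by fun_prop : Continuous fun s : ℝ => 1 - s ^ 3).tendsto 0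
    · filter_upwards [self_mem_nhdsWithin] with s hs
      have : 0 < s ^ 3 := pow_pos hs 3
      simpa using this
  have h2 : Tendsto (fun s : ℝ => ‖g (1 - ζ ^ 3) - g ((1 - s ^ 3 : ℝ) : ℂ)‖)
      (nhdsWithin 0 (Ioi 0)) (nhds ‖g (1 - ζ ^ 3) - 1‖) :=
    ((tendsto_g_ofReal_one.comp h1).const_sub _).norm
  have h3 : Tendsto (fun s : ℝ => 3 * gConst * ‖ζ - (s : ℂ)‖)
      (nhdsWithin 0 (Ioi 0)) (nhds (3 * gConst * ‖ζ‖)) := by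
    refine Tendsto.mono_left ?_ nhdsWithin_le_nhds
    simpa using (by fun_prop : Continuous fun s : ℝ => 3 * gConst * ‖ζ - (s : ℂ)‖).tendsto 0
  refine le_of_tendsto_of_tendsto h2 h3 ?_
  filter_upwards [Ioo_mem_nhdsGT zero_lt_one] with s hs
  have hn : ‖(s : ℂ)‖ = s := by rw [norm_real, Real.norm_of_nonneg hs.1.le]
  have := norm_g_one_sub_cube_sub_le hζ hζ1 (η := s) (by rw [hn, ofReal_re]; linarith [hs.1])
    (by rw [hn]; exact hs.2)
  push_cast
  exact this

theorem norm_cpow_third_lt {w : ℂ} (hw : w ∈ slitPlane) :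
    ‖w ^ (1 / 3 : ℂ)‖ < 2 * (w ^ (1 / 3 : ℂ)).re := by
  have hw0 := slitPlane_ne_zero hw
  have harg := mem_slitPlane_iff_arg.1 hw
  have h1 := neg_pi_lt_arg w
  have h2 := lt_of_le_of_ne (arg_le_pi w) harg.1
  have e : w ^ (1 / 3 : ℂ) = exp (((Real.log ‖w‖ / 3 : ℝ) : ℂ) + ((w.arg / 3 : ℝ) : ℂ) * I) := by
    rw [cpow_def_of_ne_zero hw0, Complex.log]
    push_cast
    ring_nf
  rw [e, norm_exp, exp_re]
  simp only [add_re, ofReal_re, mul_re, I_re, ofReal_im, I_im, add_im, mul_im]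
  ring_nf
  have hc : 1 / 2 < Real.cos (w.arg * (1 / 3)) := by
    rw [← Real.cos_pi_div_three, ← Real.cos_abs (w.arg * (1 / 3))]
    refine Real.cos_lt_cos_of_nonneg_of_le_pi (abs_nonneg _) (by linarith [Real.pi_pos]) ?_
    rw [abs_lt]
    constructor <;> linarith
  have := Real.exp_pos (Real.log ‖w‖ * (1 / 3))
  nlinarith

theorem tendsto_g_one : Tendsto g (nhdsWithin 1 Dslit) (nhds 1) := by
  rw [tendsto_iff_norm_sub_tendsto_zero]
  have h0 : Tendsto (fun z : ℂ => ‖1 - z‖ ^ (1 / 3 : ℝ)) (nhdsWithin 1 Dslit) (nhds 0) := by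
    refine Tendsto.mono_left ?_ nhdsWithin_le_nhds
    have : Continuous fun z : ℂ => ‖1 - z‖ ^ (1 / 3 : ℝ) :=
      (by fun_prop : Continuous fun z : ℂ => ‖1 - z‖).rpow_const fun _ => Or.inr (by norm_num)
    simpa [Real.zero_rpow] using this.tendsto 1
  have h1 : Tendsto (fun z : ℂ => 3 * gConst * ‖1 - z‖ ^ (1 / 3 : ℝ)) (nhdsWithin 1 Dslit)
      (nhds 0) := by simpa using h0.const_mul (3 * gConst)
  refine squeeze_zero' (Filter.Eventually.of_forall fun _ => norm_nonneg _) ?_ h1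
  filter_upwards [h0.eventually_lt_const zero_lt_one, self_mem_nhdsWithin] with z hz hD
  have hs : 1 - z ∈ slitPlane := by
    rw [mem_slitPlane_iff]
    by_contra! h
    simp only [sub_re, one_re, sub_im, one_im] at h
    exact hD ⟨by linarith [h.2], Or.inr (by linarith [h.1])⟩
  have hn : ‖(1 - z) ^ (1 / 3 : ℂ)‖ = ‖1 - z‖ ^ (1 / 3 : ℝ) := by
    rw [← norm_cpow_real]; push_cast; rfl
  have hcube : ((1 - z) ^ (1 / 3 : ℂ)) ^ 3 = 1 - z := by
    rw [← cpow_nat_mul]; norm_num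
  have := norm_g_one_sub_cube_sub_one_le (norm_cpow_third_lt hs) (by rw [hn]; exact hz)
  rwa [hcube, hn, sub_sub_cancel] at this

theorem tendsto_g_neg_one : Tendsto g (nhdsWithin (-1) Dslit) (nhds (-1)) := by
  have h : Tendsto (fun z : ℂ => -z) (nhdsWithin (-1) Dslit) (nhdsWithin 1 Dslit) := by
    refine tendsto_nhdsWithin_iff.2 ⟨?_, ?_⟩
    · refine Tendsto.mono_left ?_ nhdsWithin_le_nhds
      simpa using (continuous_neg (G := ℂ)).tendsto (-1)
    · filter_upwards [self_mem_nhdsWithin] with z hz hs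
      refine hz ⟨by simpa using hs.1, ?_⟩
      rcases hs.2 with h | h <;> simp only [neg_re] at h
      · right; linarith
      · left; linarith
  refine ((tendsto_g_one.comp h).neg).congr fun z => ?_
  simp [g_neg]

/-- The primitive cube root of unity `exp (2πi/3)`. -/
noncomputable def cubeRoot : ℂ := ⟨-1 / 2, Real.sqrt 3 / 2⟩

theorem cubeRoot_eq_exp : cubeRoot = exp (2 / 3 * (Real.pi * I)) := by
  have e : (2 / 3 * (Real.pi * I) : ℂ) = ((Real.pi - Real.pi / 3 : ℝ) : ℂ) * I := by
    push_cast; ring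
  rw [e, exp_mul_I, ← ofReal_cos, ← ofReal_sin, Real.cos_pi_sub, Real.sin_pi_sub,
    Real.cos_pi_div_three, Real.sin_pi_div_three]
  apply Complex.ext <;> simp [cubeRoot]
  norm_num

/-- The Möbius automorphism of the upper half-plane with `1 ↦ -1`, `∞ ↦ 1`, `-1 ↦ ∞`. -/
noncomputable def rotateHalfPlane (z : ℂ) : ℂ := 1 - 4 / (z + 1)

theorem add_one_ne_zero_of_im_pos {z : ℂ} (hz : 0 < z.im) : z + 1 ≠ 0 := by
  intro h
  have := congrArg im h
  simp at this
  linarith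

theorem im_neg_inv_pos {z : ℂ} (hz : 0 < z.im) {a : ℝ} (ha : 0 < a) :
    0 < (-((a : ℂ) / z)).im := by
  have h0 : 0 < normSq z := normSq_pos.2 (by rintro rfl; simp at hz)
  rw [neg_im, div_im]
  simp only [ofReal_im, ofReal_re, zero_mul, zero_div, zero_sub, neg_neg]
  positivity

theorem rotateHalfPlane_im_pos {z : ℂ} (hz : 0 < z.im) : 0 < (rotateHalfPlane z).im := by
  have h := im_neg_inv_pos (z := z + 1) (by simpa using hz) (a := 4) (by norm_num)
  rw [neg_im] at h
  simp only [rotateHalfPlane, sub_im, one_im]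
  push_cast at h
  linarith

theorem hasDerivAt_rotateHalfPlane {z : ℂ} (hz : 0 < z.im) :
    HasDerivAt rotateHalfPlane (4 / (z + 1) ^ 2) z := by
  have h0 := add_one_ne_zero_of_im_pos hz
  have h := (((hasDerivAt_id z).add_const 1).inv h0).const_mul (4 : ℂ) |>.const_sub 1
  refine (h.congr_deriv ?_).congr_of_eventuallyEq (Filter.Eventually.of_forall fun w => ?_)
  · simp only [id]; ring
  · simp [rotateHalfPlane, div_eq_mul_inv]

theorem cubeRoot_mul_cpow {z : ℂ} (hz : 0 < z.im) :
    cubeRoot * ((1 - rotateHalfPlane z ^ 2) ^ (-(2 / 3) : ℂ) * (4 / (z + 1) ^ 2)) =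
      (1 - z ^ 2) ^ (-(2 / 3) : ℂ) := by
  have hp0 := add_one_ne_zero_of_im_pos hz
  have hm0 : 1 - z ≠ 0 := by
    intro h
    have := congrArg im h
    simp at this
    linarith
  have hq : 0 < ((z - 1) / (z + 1)).im := by
    have h := im_neg_inv_pos (z := z + 1) (by simpa using hz) (a := 2) (by norm_num)
    have e : (z - 1) / (z + 1) = 1 + -(((2 : ℝ) : ℂ) / (z + 1)) := by
      field_simp; push_cast; ring
    rw [e, add_im, one_im]
    linarith
  have arg_bounds : ∀ {w : ℂ}, 0 < w.im → 0 < w.arg ∧ w.arg < Real.pi := by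
    intro w hw
    refine ⟨lt_of_le_of_ne (arg_nonneg_iff.2 hw.le) fun h => ?_, arg_lt_pi_iff.2 (Or.inr hw.ne')⟩
    exact hw.ne' (arg_eq_zero_iff.1 h.symm).2
  obtain ⟨hq1, hq2⟩ := arg_bounds hq
  obtain ⟨hp1, hp2⟩ := arg_bounds (w := z + 1) (by simpa using hz)
  have hm1 : (1 - z).arg < 0 := arg_neg_iff.2 (by simpa using hz)
  have hm2 := neg_pi_lt_arg (1 - z)
  have hpi := Real.pi_pos
  have expp := exp_log hp0
  have expm := exp_log hm0
  have hq0 : (z - 1) / (z + 1) ≠ 0 := by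
    intro h; rw [h] at hq; simp at hq
  have logA : log (1 - z ^ 2) = log (1 - z) + log (z + 1) := by
    rw [← log_exp (x := log (1 - z) + log (z + 1)), exp_add, expp, expm]
    · ring_nf
    · simp only [add_im, log_im]; linarith
    · simp only [add_im, log_im]; linarith
  have logq : log ((z - 1) / (z + 1)) = log (1 - z) + Real.pi * I - log (z + 1) := by
    rw [← log_exp (x := log (1 - z) + Real.pi * I - log (z + 1)), exp_sub, exp_add, expp, expm,
      exp_pi_mul_I]
    · ring_nf
    · simp only [add_im, sub_im, mul_im, log_im, I_im, I_re, ofReal_im, ofReal_re]; linarith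
    · simp only [add_im, sub_im, mul_im, log_im, I_im, I_re, ofReal_im, ofReal_re]; linarith
  have hB : 1 - rotateHalfPlane z ^ 2 = 8 * ((z - 1) / (z + 1)) / (z + 1) := by
    unfold rotateHalfPlane; field_simp; ring
  have exp8 : exp ((Real.log 8 : ℝ) : ℂ) = 8 := by
    rw [← ofReal_exp, Real.exp_log (by norm_num)]; norm_num
  have logB : log (1 - rotateHalfPlane z ^ 2) =
      (Real.log 8 : ℝ) + log ((z - 1) / (z + 1)) - log (z + 1) := by
    rw [← log_exp (x := (Real.log 8 : ℝ) + log ((z - 1) / (z + 1)) - log (z + 1)), exp_sub,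
      exp_add, expp, exp_log hq0, exp8, hB]
    · simp only [add_im, sub_im, log_im, ofReal_im]; linarith
    · simp only [add_im, sub_im, log_im, ofReal_im]; linarith
  have hA0 : 1 - z ^ 2 ≠ 0 := by
    rw [show 1 - z ^ 2 = (1 - z) * (z + 1) by ring]; exact mul_ne_zero hm0 hp0
  have hB0 : 1 - rotateHalfPlane z ^ 2 ≠ 0 := by
    rw [hB]; exact div_ne_zero (mul_ne_zero (by norm_num) hq0) hp0
  have e4 : (4 : ℂ) = exp (2 / 3 * (Real.log 8 : ℝ)) := by
    rw [show (2 / 3 * (Real.log 8 : ℝ) : ℂ) = ((2 * Real.log 2 : ℝ) : ℂ) by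
      rw [show (8 : ℝ) = 2 ^ 3 by norm_num, Real.log_pow]; push_cast; ring]
    rw [← ofReal_exp, mul_comm, Real.exp_mul, Real.exp_log (by norm_num)]
    norm_num
  have esq : (z + 1) ^ 2 = exp (2 * log (z + 1)) := by
    rw [two_mul, exp_add, expp, sq]
  rw [cubeRoot_eq_exp, cpow_def_of_ne_zero hA0, cpow_def_of_ne_zero hB0, logA, logB, logq, e4, esq,
    ← exp_sub, ← exp_add, ← exp_add]
  congr 1
  ring

theorem isOpen_upperHalf : IsOpen {z : ℂ | 0 < z.im} := isOpen_lt continuous_const continuous_im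

theorem mem_Dslit_of_im_pos {z : ℂ} (hz : 0 < z.im) : z ∈ Dslit := mem_Dslit_of_im_ne_zero hz.ne'

/-- `g` intertwines `rotateHalfPlane` with the rotation of the triangle `-1, 1, i√3`. -/
theorem g_eq_rotate {z : ℂ} (hz : 0 < z.im) :
    g z = 1 + cubeRoot + cubeRoot * g (rotateHalfPlane z) := by
  have hder : ∀ z ∈ {z : ℂ | 0 < z.im},
      HasDerivAt (fun z => g z - cubeRoot * g (rotateHalfPlane z)) 0 z := by
    intro z hz
    have h1 := (hasDerivAt_g (mem_Dslit_of_im_pos (rotateHalfPlane_im_pos hz))).comp z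
      (hasDerivAt_rotateHalfPlane hz)
    refine ((hasDerivAt_g (mem_Dslit_of_im_pos hz)).sub (h1.const_mul cubeRoot)).congr_deriv ?_
    rw [← cubeRoot_mul_cpow hz]
    ring
  have hconst : ∀ w ∈ {z : ℂ | 0 < z.im}, g w - cubeRoot * g (rotateHalfPlane w) =
      g z - cubeRoot * g (rotateHalfPlane z) := fun w hw =>
    isOpen_upperHalf.is_const_of_deriv_eq_zero (convex_halfSpace_im_gt 0).isPreconnected
      (fun z hz => (hder z hz).differentiableAt.differentiableWithinAt)
      (fun z hz => (hder z hz).deriv) hw hz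
  have hne : (nhdsWithin (1 : ℂ) {z : ℂ | 0 < z.im}).NeBot := by
    rw [← mem_closure_iff_nhdsWithin_neBot, closure_setOfPred_lt_im]
    simp
  have hsub : {z : ℂ | 0 < z.im} ⊆ Dslit := fun z hz => mem_Dslit_of_im_pos hz
  have h1 : Tendsto g (nhdsWithin 1 {z : ℂ | 0 < z.im}) (nhds 1) :=
    tendsto_g_one.mono_left (nhdsWithin_mono _ hsub)
  have h2 : Tendsto rotateHalfPlane (nhdsWithin 1 {z : ℂ | 0 < z.im}) (nhdsWithin (-1) Dslit) := by
    refine tendsto_nhdsWithin_iff.2 ⟨?_, ?_⟩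
    · refine Tendsto.mono_left ?_ nhdsWithin_le_nhds
      have : ContinuousAt rotateHalfPlane 1 :=
        continuousAt_const.sub (continuousAt_const.div (by fun_prop) (by norm_num))
      have h := this.tendsto
      rwa [show rotateHalfPlane 1 = -1 by norm_num [rotateHalfPlane]] at h
    · filter_upwards [self_mem_nhdsWithin] with z hz
      exact mem_Dslit_of_im_pos (rotateHalfPlane_im_pos hz)
  have h3 := h1.sub ((tendsto_g_neg_one.comp h2).const_mul cubeRoot)
  have h4 := tendsto_nhds_unique (h3.congr' (by
    filter_upwards [self_mem_nhdsWithin] with w hw using hconst w hw)) tendsto_const_nhds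
  linear_combination -h4

theorem cpow_neg_half_re_pos {w : ℂ} (hw : w ∈ slitPlane) : 0 < (w ^ (-(1 / 2) : ℂ)).re := by
  have harg := mem_slitPlane_iff_arg.1 hw
  have h1 := neg_pi_lt_arg w
  have h2 := lt_of_le_of_ne (arg_le_pi w) harg.1
  have e : Complex.log w * (-(1 / 2)) =
      ((-(Real.log ‖w‖) / 2 : ℝ) : ℂ) + ((-w.arg / 2 : ℝ) : ℂ) * I := by
    rw [Complex.log]
    push_cast
    ring
  rw [cpow_def_of_ne_zero (slitPlane_ne_zero hw), e, exp_re]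
  refine mul_pos (Real.exp_pos _) (Real.cos_pos_of_mem_Ioo ⟨?_, ?_⟩)
  · simp; linarith
  · simp; linarith

/-- In the closed first quadrant, away from the real axis, `z (1-tz²)^(-1/2)` lies in the
first quadrant. -/
theorem eulerIntegrand_quadrant {z : ℂ} (hr : 0 ≤ z.re) (hi : 0 < z.im) {t : ℝ}
    (ht : t ∈ Ioo (0:ℝ) 1) :
    0 < (z * (1 - (t : ℂ) * z ^ 2) ^ (-(1 / 2) : ℂ)).im ∧
      (0 < z.re → 0 < (z * (1 - (t : ℂ) * z ^ 2) ^ (-(1 / 2) : ℂ)).re) := by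
  have hs := one_sub_mul_mem_slitPlane (one_sub_sq_mem_slitPlane (mem_Dslit_of_im_pos hi))
    ⟨ht.1.le, ht.2.le⟩
  have hs0 := slitPlane_ne_zero hs
  have hz0 : z ≠ 0 := by rintro rfl; simp at hi
  set w := 1 - (t : ℂ) * z ^ 2 with hw
  set v := w ^ (-(1 / 2) : ℂ) with hv
  have hvre : 0 < v.re := cpow_neg_half_re_pos hs
  have hvw : v ^ 2 = w⁻¹ := by
    rw [hv, ← cpow_nat_mul, show ((2 : ℕ) : ℂ) * -(1 / 2) = -1 by norm_num, cpow_neg_one]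
  have hwim : w.im = -(2 * t * z.re * z.im) := by
    simp only [hw, sub_im, one_im, mul_im, ofReal_re, ofReal_im, sq]
    ring
  have hn : 0 < normSq w := normSq_pos.2 hs0
  have hvim2 : 2 * v.re * v.im = 2 * t * z.re * z.im / normSq w := by
    have := congrArg im hvw
    rw [inv_im, hwim, neg_neg, sq, mul_im] at this
    linarith
  have ht0 := ht.1
  have hvim : 0 ≤ v.im := by
    have : 0 ≤ 2 * v.re * v.im := by rw [hvim2]; positivity
    by_contra! h
    nlinarith
  have him : 0 < (z * v).im := by
    rw [mul_im]
    have := mul_nonneg hr hvim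
    have := mul_pos hi hvre
    linarith
  refine ⟨him, fun hr' => ?_⟩
  have hsq : (z * v) ^ 2 * (1 - (t : ℂ) * z ^ 2) = z ^ 2 := by
    rw [mul_pow, hvw, ← hw, mul_assoc, inv_mul_cancel₀ hs0, mul_one]
  have hu : (z * v) ^ 2 = ((z ^ 2)⁻¹ - t)⁻¹ := by
    rw [mul_pow, hvw, hw]
    have h2 : (z ^ 2)⁻¹ - (t : ℂ) = (1 - t * z ^ 2) * (z ^ 2)⁻¹ := by
      field_simp
    rw [h2, mul_inv, inv_inv, mul_comm]
  have hne : (z ^ 2)⁻¹ - (t : ℂ) ≠ 0 := by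
    intro h
    rw [h, inv_zero] at hu
    rw [hu, zero_mul] at hsq
    exact pow_ne_zero 2 hz0 hsq.symm
  have h3 : 0 < 2 * (z * v).re * (z * v).im := by
    have := congrArg im hu
    rw [inv_im, sq, mul_im] at this
    have h4 : ((z ^ 2)⁻¹ - (t : ℂ)).im = -(2 * z.re * z.im) / normSq (z ^ 2) := by
      rw [sub_im, inv_im, ofReal_im, sq, mul_im]; ring
    rw [h4, ← neg_div, neg_neg] at this
    have h5 : 0 < normSq ((z ^ 2)⁻¹ - (t : ℂ)) := normSq_pos.2 hne
    have h6 : 0 < normSq (z ^ 2) := normSq_pos.2 (pow_ne_zero 2 hz0)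
    have h7 : 0 < 2 * z.re * z.im / normSq (z ^ 2) / normSq ((z ^ 2)⁻¹ - (t : ℂ)) := by positivity
    linarith
  by_contra! h
  nlinarith

theorem g_eq_integral {z : ℂ} : ∃ K : ℝ, 0 < K ∧
    g z = K * ∫ t in (0:ℝ)..1, ((t ^ (-(1 / 3) : ℝ) * (1 - t) ^ (-(1 / 6) : ℝ) : ℝ) : ℂ) *
      (z * (1 - (t : ℂ) * z ^ 2) ^ (-(1 / 2) : ℂ)) := by
  have h1 : 0 < Real.Gamma (2 / 3) := Real.Gamma_pos_of_pos (by norm_num)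
  have h2 : 0 < Real.Gamma (3 / 2 - 2 / 3) := Real.Gamma_pos_of_pos (by norm_num)
  have h3 : 0 < Real.Gamma (3 / 2) := Real.Gamma_pos_of_pos (by norm_num)
  have h4 := gConst_pos
  refine ⟨gConst * (Real.Gamma (3 / 2) / (Real.Gamma (2 / 3) * Real.Gamma (3 / 2 - 2 / 3))),
    by positivity, ?_⟩
  have e : ∫ t in (0:ℝ)..1, ((t ^ (-(1 / 3) : ℝ) * (1 - t) ^ (-(1 / 6) : ℝ) : ℝ) : ℂ) *
      (z * (1 - (t : ℂ) * z ^ 2) ^ (-(1 / 2) : ℂ)) =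
      z * eulerIntegral (2 / 3) (3 / 2 - 2 / 3) (1 / 2) (z ^ 2) := by
    rw [eulerIntegral, ← intervalIntegral.integral_const_mul]
    refine intervalIntegral.integral_congr fun t ht => ?_
    rw [uIcc_of_le zero_le_one] at ht
    rw [ofReal_mul, ofReal_cpow ht.1, ofReal_cpow (by linarith [ht.2] : (0:ℝ) ≤ 1 - t)]
    push_cast
    rw [show (2 / 3 - 1 : ℂ) = -(1 / 3) by norm_num,
      show (3 / 2 - 2 / 3 - 1 : ℂ) = -(1 / 6) by norm_num]
    ring
  rw [e, g_eq]
  push_cast [← Complex.Gamma_ofReal]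
  ring

theorem g_quadrant {z : ℂ} (hr : 0 ≤ z.re) (hi : 0 < z.im) :
    0 < (g z).im ∧ (0 < z.re → 0 < (g z).re) := by
  obtain ⟨K, hK, hg⟩ := g_eq_integral (z := z)
  have hD := one_sub_sq_mem_slitPlane (mem_Dslit_of_im_pos hi)
  have hint : IntervalIntegrable (fun t : ℝ =>
      ((t ^ (-(1 / 3) : ℝ) * (1 - t) ^ (-(1 / 6) : ℝ) : ℝ) : ℂ) *
      (z * (1 - (t : ℂ) * z ^ 2) ^ (-(1 / 2) : ℂ))) MeasureTheory.volume 0 1 := by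
    refine ((intervalIntegrable_eulerIntegrand (b := 2 / 3) (d := 3 / 2 - 2 / 3) (by norm_num)
      (by norm_num) (1 / 2) hD).const_mul z).congr fun t ht => ?_
    rw [uIoc_of_le zero_le_one] at ht
    rw [ofReal_mul, ofReal_cpow ht.1.le, ofReal_cpow (by linarith [ht.2] : (0:ℝ) ≤ 1 - t)]
    push_cast
    rw [show (2 / 3 - 1 : ℂ) = -(1 / 3) by norm_num,
      show (3 / 2 - 2 / 3 - 1 : ℂ) = -(1 / 6) by norm_num]
    ring
  have hw : ∀ t ∈ Ioo (0:ℝ) 1, 0 < t ^ (-(1 / 3) : ℝ) * (1 - t) ^ (-(1 / 6) : ℝ) := fun t ht =>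
    mul_pos (Real.rpow_pos_of_pos ht.1 _) (Real.rpow_pos_of_pos (by linarith [ht.2]) _)
  rw [hg, im_ofReal_mul, re_ofReal_mul]
  have eim := imCLM.intervalIntegral_comp_comm hint
  have ere := reCLM.intervalIntegral_comp_comm hint
  simp only [imCLM_apply, reCLM_apply, im_ofReal_mul, re_ofReal_mul] at eim ere
  rw [← eim, ← ere]
  have iim := imCLM.integrable_comp hint.1
  have ire := reCLM.integrable_comp hint.1
  simp only [imCLM_apply, reCLM_apply, im_ofReal_mul, re_ofReal_mul] at iim ire
  refine ⟨mul_pos hK (intervalIntegral.intervalIntegral_pos_of_pos_on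
      ((intervalIntegrable_iff_integrableOn_Ioc_of_le zero_le_one).2 iim)
      (fun t ht => mul_pos (hw t ht) (eulerIntegrand_quadrant hr hi ht).1) zero_lt_one),
    fun hr' => mul_pos hK (intervalIntegral.intervalIntegral_pos_of_pos_on
      ((intervalIntegrable_iff_integrableOn_Ioc_of_le zero_le_one).2 ire)
      (fun t ht => mul_pos (hw t ht) ((eulerIntegrand_quadrant hr hi ht).2 hr')) zero_lt_one)⟩

open scoped ComplexConjugate in
theorem g_neg_conj {z : ℂ} (hz : z ∈ Dslit) : g (-conj z) = -conj (g z) := by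
  rw [g_neg, g_conj hz]

theorem g_im_pos {z : ℂ} (hz : 0 < z.im) : 0 < (g z).im := by
  rcases le_total 0 z.re with h | h
  · exact (g_quadrant h hz).1
  · have := (g_quadrant (z := -(starRingEnd ℂ z)) (by simpa using h) (by simpa using hz)).1
    rw [g_neg_conj (mem_Dslit_of_im_pos hz)] at this
    simpa using this

theorem g_re_neg {z : ℂ} (hr : z.re < 0) (hz : 0 < z.im) : (g z).re < 0 := by
  have := (g_quadrant (z := -(starRingEnd ℂ z)) (by simpa using hr.le) (by simpa using hz)).2
    (by simpa using hr)
  rw [g_neg_conj (mem_Dslit_of_im_pos hz)] at this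
  simpa using this

theorem g_re_nonneg {z : ℂ} (hr : 0 ≤ z.re) (hz : 0 < z.im) : 0 ≤ (g z).re := by
  rcases hr.eq_or_lt with h | h
  · have e : -(starRingEnd ℂ z) = z := by apply Complex.ext <;> simp [← h]
    have := congrArg re (g_neg_conj (mem_Dslit_of_im_pos hz))
    rw [e] at this
    simp at this
    linarith
  · exact ((g_quadrant hr hz).2 h).le

/-- The Noshiro–Warschawski criterion: a function on a convex set whose derivative takes values in
an open half-plane bounded by a line through `0` is injective. -/
theorem injOn_of_re_mul_deriv_pos {s : Set ℂ} (hs : Convex ℝ s) {f f' : ℂ → ℂ} (c : ℂ)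
    (hf : ∀ z ∈ s, HasDerivAt f (f' z) z) (hpos : ∀ z ∈ s, 0 < (c * f' z).re) : InjOn f s := by
  intro z hz w hw h
  by_contra! hne
  have hne' : w - z ≠ 0 := sub_ne_zero.2 hne.symm
  have hmem : ∀ t ∈ Icc (0:ℝ) 1, z + (t : ℂ) * (w - z) ∈ s := by
    intro t ht
    have := hs.add_smul_sub_mem hz hw ht
    simpa using this
  have hder : ∀ t ∈ Icc (0:ℝ) 1,
      HasDerivAt (fun t : ℝ => (c / (w - z) * f (z + (t : ℂ) * (w - z))).re)
        (c * f' (z + (t : ℂ) * (w - z))).re t := by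
    intro t ht
    have h1 : HasDerivAt (fun x : ℂ => z + x * (w - z)) (w - z) (t : ℂ) := by
      simpa using ((hasDerivAt_id (t : ℂ)).mul_const (w - z)).const_add z
    have h2 := (((hf _ (hmem t ht)).comp (t : ℂ) h1).const_mul (c / (w - z))).real_of_complex
    refine h2.congr_deriv ?_
    congr 1
    field_simp
  obtain ⟨t, ht, h0⟩ := exists_hasDerivAt_eq_zero zero_lt_one
    (fun t ht => (hder t ht).continuousAt.continuousWithinAt) (by simp [h])
    (fun t ht => hder t (Ioo_subset_Icc_self ht))
  exact (hpos _ (hmem t (Ioo_subset_Icc_self ht))).ne' h0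

theorem injOn_g_quadrant : InjOn g {z : ℂ | 0 ≤ z.re ∧ 0 < z.im} := by
  refine injOn_of_re_mul_deriv_pos ?_ (exp (-(Real.pi / 6 : ℝ) * I))
    (fun z hz => hasDerivAt_g (mem_Dslit_of_im_pos hz.2)) fun z hz => ?_
  · exact (convex_halfSpace_re_ge 0).inter (convex_halfSpace_im_gt 0)
  · have hs := one_sub_sq_mem_slitPlane (mem_Dslit_of_im_pos hz.2)
    have harg := mem_slitPlane_iff_arg.1 hs
    have h1 := neg_pi_lt_arg (1 - z ^ 2)
    have him : (1 - z ^ 2).im ≤ 0 := by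
      simp only [sub_im, one_im, sq, mul_im]
      have := mul_nonneg hz.1 hz.2.le
      linarith
    have h2 : (1 - z ^ 2).arg ≤ 0 := by
      rcases him.eq_or_lt with h | h
      · refine (arg_eq_zero_iff.2 ⟨?_, h⟩).le
        rcases mem_slitPlane_iff.1 hs with h' | h'
        · exact h'.le
        · exact absurd h h'
      · exact (arg_neg_iff.2 h).le
    have e : exp (-(Real.pi / 6 : ℝ) * I) * (gConst * (1 - z ^ 2) ^ (-(2 / 3) : ℂ)) =
        gConst * exp (((-(2 / 3) * Real.log ‖1 - z ^ 2‖ : ℝ) : ℂ) +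
          ((-(2 / 3) * (1 - z ^ 2).arg - Real.pi / 6 : ℝ) : ℂ) * I) := by
      rw [cpow_def_of_ne_zero (slitPlane_ne_zero hs), mul_left_comm, ← exp_add, Complex.log]
      congr 2
      push_cast
      ring
    rw [e, re_ofReal_mul, exp_re]
    refine mul_pos gConst_pos (mul_pos (Real.exp_pos _) (Real.cos_pos_of_mem_Ioo ⟨?_, ?_⟩))
    · simp; linarith [Real.pi_pos]
    · simp; linarith

theorem injOn_g_upperHalf : InjOn g {z : ℂ | 0 < z.im} := by
  intro z hz w hw h
  simp only [mem_ofPred_eq] at hz hw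
  rcases le_or_gt 0 z.re with h1 | h1 <;> rcases le_or_gt 0 w.re with h2 | h2
  · exact injOn_g_quadrant ⟨h1, hz⟩ ⟨h2, hw⟩ h
  · have := g_re_nonneg h1 hz
    have := g_re_neg h2 hw
    rw [h] at *
    linarith
  · have := g_re_nonneg h2 hw
    have := g_re_neg h1 hz
    rw [h] at *
    linarith
  · have hc : g (-(starRingEnd ℂ z)) = g (-(starRingEnd ℂ w)) := by
      rw [g_neg_conj (mem_Dslit_of_im_pos hz), g_neg_conj (mem_Dslit_of_im_pos hw), h]
    have := injOn_g_quadrant ⟨by simpa using h1.le, by simpa using hz⟩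
      ⟨by simpa using h2.le, by simpa using hw⟩ hc
    exact (starRingEnd ℂ).injective (by simpa using this)

theorem sqrt_three_sq : Real.sqrt 3 * Real.sqrt 3 = 3 := Real.mul_self_sqrt (by norm_num)

theorem sqrt_three_mul_re_add_im (w : ℂ) :
    Real.sqrt 3 * (1 + cubeRoot + cubeRoot * w).re + (1 + cubeRoot + cubeRoot * w).im =
      Real.sqrt 3 - 2 * w.im := by
  simp only [cubeRoot, add_re, add_im, one_re, one_im, mul_re, mul_im]
  linear_combination (-w.im / 2) * sqrt_three_sq

theorem g_mem_rhombus {z : ℂ} (hz : 0 < z.im) : g z ∈ rhombus := by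
  have key : ∀ {z : ℂ}, 0 < z.im → Real.sqrt 3 * (g z).re + (g z).im < Real.sqrt 3 := by
    intro z hz
    rw [g_eq_rotate hz, sqrt_three_mul_re_add_im]
    linarith [g_im_pos (rotateHalfPlane_im_pos hz)]
  have h1 := key hz
  have h2 := key (z := -(starRingEnd ℂ z)) (by simpa using hz)
  rw [g_neg_conj (mem_Dslit_of_im_pos hz)] at h2
  simp only [neg_re, conj_re, neg_im, conj_im, neg_neg] at h2
  simp only [rhombus, mem_ofPred_eq, abs_of_pos (g_im_pos hz)]
  rcases abs_cases (g z).re with ⟨h, -⟩ | ⟨h, -⟩ <;> rw [h] <;> assumption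

theorem isOpen_image_g_upperHalf : IsOpen (g '' {z : ℂ | 0 < z.im}) := by
  rw [isOpen_iff_mem_nhds]
  rintro _ ⟨z, hz, rfl⟩
  have hD := mem_Dslit_of_im_pos hz
  have hdiff : DifferentiableOn ℂ g Dslit := fun w hw =>
    (hasDerivAt_g hw).differentiableAt.differentiableWithinAt
  have hstrict := (hdiff.analyticAt (isOpen_Dslit.mem_nhds hD)).hasStrictDerivAt
  rw [(hasDerivAt_g hD).deriv] at hstrict
  rw [← hstrict.map_nhds_eq]
  · exact Filter.image_mem_map (isOpen_upperHalf.mem_nhds hz)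
  · have : (gConst : ℂ) ≠ 0 := by exact_mod_cast gConst_pos.ne'
    exact mul_ne_zero this fun h =>
      slitPlane_ne_zero (one_sub_sq_mem_slitPlane hD) ((cpow_eq_zero_iff _ _).1 h).1

/-- The open upper half of the rhombus. -/
def upperTriangle : Set ℂ := rhombus ∩ {z | 0 < z.im}

theorem convex_upperTriangle : Convex ℝ upperTriangle := by
  have h : upperTriangle = {z : ℂ | Real.sqrt 3 * z.re + z.im < Real.sqrt 3} ∩
      {z : ℂ | -Real.sqrt 3 * z.re + z.im < Real.sqrt 3} ∩ {z | 0 < z.im} := by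
    ext z
    simp only [upperTriangle, rhombus, mem_inter_iff, mem_ofPred_eq]
    refine and_congr_left fun hz => ?_
    have e : Real.sqrt 3 * |z.re| = |Real.sqrt 3 * z.re| := by
      rw [abs_mul, abs_of_nonneg (Real.sqrt_nonneg 3)]
    rw [abs_of_pos hz, e, ← lt_sub_iff_add_lt, abs_lt]
    constructor
    · rintro ⟨h1, h2⟩; constructor <;> linarith
    · rintro ⟨h1, h2⟩; constructor <;> linarith
  have hlin : ∀ a : ℝ, IsLinearMap ℝ fun z : ℂ => a * z.re + z.im := fun a =>
    ⟨fun x y => by simp only [add_re, add_im]; ring,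
      fun r x => by simp only [smul_re, smul_im, smul_eq_mul]; ring⟩
  rw [h]
  exact ((convex_halfSpace_lt (hlin _) _).inter (convex_halfSpace_lt (hlin _) _)).inter
    (convex_halfSpace_im_gt 0)

theorem tendsto_rotateHalfPlane_cobounded :
    Tendsto rotateHalfPlane (Bornology.cobounded ℂ) (nhds 1) := by
  have h1 : Tendsto (fun z : ℂ => z + 1) (Bornology.cobounded ℂ) (Bornology.cobounded ℂ) :=
    tendsto_add_const_cobounded 1
  have h2 := ((tendsto_inv₀_cobounded.comp h1).const_mul (4 : ℂ)).const_sub 1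
  rw [mul_zero, sub_zero] at h2
  refine h2.congr fun z => ?_
  simp [rotateHalfPlane, div_eq_mul_inv]

theorem not_mem_upperTriangle_of_tendsto_cobounded {u : ℕ → ℂ} {w : ℂ}
    (hu : ∀ n, 0 < (u n).im) (h : Tendsto u atTop (Bornology.cobounded ℂ))
    (hw : Tendsto (fun n => g (u n)) atTop (nhds w)) : w ∉ upperTriangle := by
  have h1 : Tendsto (fun n => rotateHalfPlane (u n)) atTop (nhdsWithin 1 Dslit) :=
    tendsto_nhdsWithin_iff.2 ⟨tendsto_rotateHalfPlane_cobounded.comp h,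
      Filter.Eventually.of_forall fun n => mem_Dslit_of_im_pos (rotateHalfPlane_im_pos (hu n))⟩
  have h2 := ((tendsto_g_one.comp h1).const_mul cubeRoot).const_add (1 + cubeRoot)
  have h3 := tendsto_nhds_unique hw (h2.congr fun n => (g_eq_rotate (hu n)).symm)
  have h4 := sqrt_three_mul_re_add_im 1
  rw [← h3] at h4
  rintro ⟨h5, h6⟩
  simp only [rhombus, mem_ofPred_eq] at h5 h6
  rw [one_im] at h4
  rw [abs_of_pos h6] at h5
  have := mul_le_mul_of_nonneg_left (le_abs_self w.re) (Real.sqrt_nonneg 3)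
  linarith

theorem not_mem_upperTriangle_of_tendsto_one_lt {u : ℕ → ℂ} {w : ℂ} {z : ℂ}
    (hu : ∀ n, 0 < (u n).im) (hz : z.im = 0) (hz1 : 1 < z.re) (h : Tendsto u atTop (nhds z))
    (hw : Tendsto (fun n => g (u n)) atTop (nhds w)) : w ∉ upperTriangle := by
  obtain ⟨x, rfl⟩ : ∃ x : ℝ, z = x := ⟨z.re, by apply Complex.ext <;> simp [hz]⟩
  rw [ofReal_re] at hz1
  have hx0 : (x : ℂ) + 1 ≠ 0 := by exact_mod_cast (by linarith : x + 1 ≠ 0)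
  have hτ : rotateHalfPlane x = ((1 - 4 / (x + 1) : ℝ) : ℂ) := by
    simp [rotateHalfPlane]
  have hmem : 1 - 4 / (x + 1) ∈ Ioo (-1 : ℝ) 1 := by
    have h0 : 0 < x + 1 := by linarith
    have h1 : 0 < 4 / (x + 1) := by positivity
    have h2 : 4 / (x + 1) < 2 := by rw [div_lt_iff₀ h0]; linarith
    constructor <;> linarith
  have hD : rotateHalfPlane x ∈ Dslit := by
    rw [hτ]
    exact mem_Dslit_of_abs_re_lt (by simpa only [ofReal_re] using hmem.1)
      (by simpa only [ofReal_re] using hmem.2)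
  have hc : ContinuousAt rotateHalfPlane x :=
    continuousAt_const.sub (continuousAt_const.div (by fun_prop) hx0)
  have h2 := (((hasDerivAt_g hD).continuousAt.tendsto.comp (hc.tendsto.comp h)).const_mul
    cubeRoot).const_add (1 + cubeRoot)
  have h3 := tendsto_nhds_unique hw (h2.congr fun n => (g_eq_rotate (hu n)).symm)
  have h4 := sqrt_three_mul_re_add_im (g (rotateHalfPlane x))
  rw [← h3, hτ, g_ofReal_im hmem] at h4
  rintro ⟨h5, h6⟩
  simp only [rhombus, mem_ofPred_eq] at h5 h6
  rw [abs_of_pos h6] at h5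
  have := mul_le_mul_of_nonneg_left (le_abs_self w.re) (Real.sqrt_nonneg 3)
  linarith

theorem mem_image_of_tendsto {u : ℕ → ℂ} {w z : ℂ} (hu : ∀ n, 0 < (u n).im)
    (h : Tendsto u atTop (nhds z)) (hw : Tendsto (fun n => g (u n)) atTop (nhds w))
    (hwT : w ∈ upperTriangle) : w ∈ g '' {z : ℂ | 0 < z.im} := by
  have hz : 0 ≤ z.im := ge_of_tendsto ((continuous_im.tendsto z).comp h)
    (Filter.Eventually.of_forall fun n => (hu n).le)
  have hwithin : Tendsto u atTop (nhdsWithin z Dslit) := tendsto_nhdsWithin_iff.2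
    ⟨h, Filter.Eventually.of_forall fun n => mem_Dslit_of_im_pos (hu n)⟩
  have hwim : 0 < w.im := hwT.2
  have hDcase : z ∈ Dslit → w = g z := fun hD =>
    tendsto_nhds_unique hw ((hasDerivAt_g hD).continuousAt.tendsto.comp h)
  rcases hz.eq_or_lt' with hz0 | hz0
  · exfalso
    obtain ⟨x, rfl⟩ : ∃ x : ℝ, z = x := ⟨z.re, by apply Complex.ext <;> simp [hz0]⟩
    rcases lt_trichotomy x 1 with h1 | rfl | h1
    · rcases lt_trichotomy x (-1) with h2 | rfl | h2
      · refine not_mem_upperTriangle_of_tendsto_one_lt (u := fun n => -(starRingEnd ℂ (u n)))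
          (w := -(starRingEnd ℂ w)) (z := -(starRingEnd ℂ x)) (fun n => by simpa using hu n)
          (by simp) (by simp; linarith) ((continuous_conj.tendsto _).comp h).neg ?_ ?_
        · refine (((continuous_conj.tendsto _).comp hw).neg).congr fun n => ?_
          exact (g_neg_conj (mem_Dslit_of_im_pos (hu n))).symm
        · simpa [upperTriangle, rhombus] using hwT
      · rw [ofReal_neg, ofReal_one] at hwithin
        have := tendsto_nhds_unique hw (tendsto_g_neg_one.comp hwithin)
        rw [this] at hwim
        simp at hwim
      · have := hDcase (mem_Dslit_of_abs_re_lt (by simpa using h2) (by simpa using h1))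
        rw [this, g_ofReal_im ⟨h2, h1⟩] at hwim
        exact lt_irrefl _ hwim
    · rw [ofReal_one] at hwithin
      have := tendsto_nhds_unique hw (tendsto_g_one.comp hwithin)
      rw [this] at hwim
      simp at hwim
    · exact not_mem_upperTriangle_of_tendsto_one_lt hu (ofReal_im x) (by simpa using h1) h hw hwT
  · exact ⟨z, hz0, (hDcase (mem_Dslit_of_im_pos hz0)).symm⟩

theorem image_g_upperHalf : g '' {z : ℂ | 0 < z.im} = upperTriangle := by
  have hsub : g '' {z : ℂ | 0 < z.im} ⊆ upperTriangle := by
    rintro _ ⟨z, hz, rfl⟩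
    exact ⟨g_mem_rhombus hz, g_im_pos hz⟩
  refine hsub.antisymm (convex_upperTriangle.isPreconnected.subset_of_closure_inter_subset
    isOpen_image_g_upperHalf ?_ ?_)
  · have hI : g I ∈ g '' {z : ℂ | 0 < z.im} := ⟨I, by simp, rfl⟩
    exact ⟨g I, hsub hI, hI⟩
  · rintro w ⟨hw, hwT⟩
    obtain ⟨v, hv, hvw⟩ := mem_closure_iff_seq_limit.1 hw
    choose u hu huv using hv
    have hgu : Tendsto (fun n => g (u n)) atTop (nhds w) := by simpa only [huv] using hvw
    by_cases hb : ∃ R : ℝ, ∃ᶠ n in atTop, u n ∈ Metric.closedBall (0 : ℂ) R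
    · obtain ⟨R, hR⟩ := hb
      obtain ⟨z, -, φ, hφ, hz⟩ := tendsto_subseq_of_frequently_bounded Metric.isBounded_closedBall hR
      exact mem_image_of_tendsto (fun n => hu (φ n)) hz (hgu.comp hφ.tendsto_atTop) hwT
    · refine absurd hwT (not_mem_upperTriangle_of_tendsto_cobounded hu ?_ hgu)
      rw [← tendsto_norm_atTop_iff_cobounded, tendsto_atTop]
      intro R
      simp only [not_exists, not_frequently] at hb
      filter_upwards [hb R] with n hn
      rw [mem_closedBall_zero_iff, not_le] at hn
      exact hn.le

theorem strictMonoOn_g_re : StrictMonoOn (fun x : ℝ => (g x).re) (Ioo (-1 : ℝ) 1) := by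
  have hder : ∀ x ∈ Ioo (-1 : ℝ) 1, HasDerivAt (fun x : ℝ => (g x).re)
      (gConst * (1 - x ^ 2) ^ (-(2 / 3) : ℝ)) x := by
    intro x hx
    have h := (hasDerivAt_g (mem_Dslit_of_abs_re_lt (z := (x : ℂ)) (by simpa using hx.1)
      (by simpa using hx.2))).real_of_complex
    refine h.congr_deriv ?_
    have hpos : 0 ≤ 1 - x ^ 2 := by nlinarith [hx.1, hx.2]
    have e : (1 - (x : ℂ) ^ 2) ^ (-(2 / 3) : ℂ) = (((1 - x ^ 2) ^ (-(2 / 3) : ℝ) : ℝ) : ℂ) := by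
      rw [ofReal_cpow hpos]; push_cast; rfl
    rw [e, ← ofReal_mul, ofReal_re]
  refine strictMonoOn_of_deriv_pos (convex_Ioo _ _)
    (fun x hx => (hder x hx).continuousAt.continuousWithinAt) fun x hx => ?_
  rw [interior_Ioo] at hx
  rw [(hder x hx).deriv]
  exact mul_pos gConst_pos (Real.rpow_pos_of_pos (by nlinarith [hx.1, hx.2]) _)

theorem image_g_re : (fun x : ℝ => (g x).re) '' Ioo (-1 : ℝ) 1 = Ioo (-1 : ℝ) 1 := by
  have hmono := strictMonoOn_g_re
  have h1 : Tendsto (fun x : ℝ => (g x).re) (nhdsWithin 1 (Iio 1)) (nhds 1) := by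
    simpa [Function.comp_def] using (continuous_re.tendsto 1).comp tendsto_g_ofReal_one
  have h2 : Tendsto (fun x : ℝ => (g x).re) (nhdsWithin (-1) (Ioi (-1))) (nhds (-1)) := by
    have hneg : Tendsto (fun x : ℝ => -x) (nhdsWithin (-1) (Ioi (-1))) (nhdsWithin 1 (Iio 1)) := by
      simpa using tendsto_neg_nhdsGT (a := (-1 : ℝ))
    refine ((h1.comp hneg).neg).congr fun x => ?_
    simp [g_neg]
  have hlt : ∀ x ∈ Ioo (-1 : ℝ) 1, (g x).re < 1 := by
    intro x hx
    obtain ⟨y, hxy, hy⟩ := exists_between hx.2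
    refine (hmono hx ⟨hx.1.trans hxy, hy⟩ hxy).trans_le (ge_of_tendsto h1 ?_)
    filter_upwards [Ioo_mem_nhdsLT hy] with s hs
    exact (hmono ⟨hx.1.trans hxy, hy⟩ ⟨(hx.1.trans hxy).trans hs.1, hs.2⟩ hs.1).le
  refine Subset.antisymm ?_ ?_
  · rintro _ ⟨x, hx, rfl⟩
    refine ⟨?_, hlt x hx⟩
    have := hlt (-x) ⟨by linarith [hx.2], by linarith [hx.1]⟩
    rw [ofReal_neg, g_neg, neg_re] at this
    linarith
  · have hcont : ContinuousOn (fun x : ℝ => (g x).re) (Ioo (-1 : ℝ) 1) := fun x hx =>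
      (hasDerivAt_g (mem_Dslit_of_abs_re_lt (z := (x : ℂ)) (by simpa using hx.1)
        (by simpa using hx.2))).real_of_complex.continuousAt.continuousWithinAt
    have hn1 : (nhdsWithin (1 : ℝ) (Iio 1)).NeBot := inferInstance
    have hn2 : (nhdsWithin (-1 : ℝ) (Ioi (-1))).NeBot := inferInstance
    exact isPreconnected_Ioo.intermediate_value_Ioo
      (le_principal_iff.2 (Ioo_mem_nhdsGT (by norm_num)))
      (le_principal_iff.2 (Ioo_mem_nhdsLT (by norm_num))) hcont h2 h1

open scoped ComplexConjugate in
theorem conj_mem_rhombus {z : ℂ} : conj z ∈ rhombus ↔ z ∈ rhombus := by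
  simp [rhombus]

theorem mem_Dslit_iff_of_im_eq_zero {x : ℝ} : (x : ℂ) ∈ Dslit ↔ x ∈ Ioo (-1 : ℝ) 1 := by
  simp [Dslit, slit, not_or]

theorem ofReal_mem_rhombus {x : ℝ} : (x : ℂ) ∈ rhombus ↔ x ∈ Ioo (-1 : ℝ) 1 := by
  have h := Real.sqrt_pos.2 (by norm_num : (0:ℝ) < 3)
  simp only [rhombus, mem_ofPred_eq, ofReal_re, ofReal_im, abs_zero, add_zero]
  rw [mul_lt_iff_lt_one_right h, abs_lt, mem_Ioo]

theorem g_ofReal {x : ℝ} (hx : x ∈ Ioo (-1 : ℝ) 1) : g x = ((g x).re : ℂ) := by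
  apply Complex.ext <;> simp [g_ofReal_im hx]

theorem exists_ofReal_eq {z : ℂ} (hz : z.im = 0) : ∃ x : ℝ, z = x :=
  ⟨z.re, by apply Complex.ext <;> simp [hz]⟩

theorem image_g : g '' Dslit = rhombus := by
  refine Subset.antisymm ?_ fun w hw => ?_
  · rintro _ ⟨z, hz, rfl⟩
    rcases lt_trichotomy z.im 0 with h | h | h
    · have := g_mem_rhombus (z := starRingEnd ℂ z) (by simpa using h)
      rwa [g_conj hz, conj_mem_rhombus] at this
    · obtain ⟨x, rfl⟩ := exists_ofReal_eq h
      have hx := mem_Dslit_iff_of_im_eq_zero.1 hz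
      rw [g_ofReal hx, ofReal_mem_rhombus, ← image_g_re]
      exact ⟨x, hx, rfl⟩
    · exact g_mem_rhombus h
  · rcases lt_trichotomy w.im 0 with h | h | h
    · have hw' : starRingEnd ℂ w ∈ upperTriangle :=
        ⟨conj_mem_rhombus.2 hw, by simpa using h⟩
      rw [← image_g_upperHalf] at hw'
      obtain ⟨z, hz, hzw⟩ := hw'
      refine ⟨starRingEnd ℂ z, mem_Dslit_of_im_ne_zero ?_, ?_⟩
      · have : 0 < z.im := hz
        simpa using this.ne'
      · rw [g_conj (mem_Dslit_of_im_pos hz), hzw, conj_conj]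
    · obtain ⟨y, rfl⟩ := exists_ofReal_eq h
      rw [ofReal_mem_rhombus, ← image_g_re] at hw
      obtain ⟨x, hx, rfl⟩ := hw
      exact ⟨x, mem_Dslit_iff_of_im_eq_zero.2 hx, g_ofReal hx⟩
    · have hw' : w ∈ upperTriangle := ⟨hw, h⟩
      rw [← image_g_upperHalf] at hw'
      obtain ⟨z, hz, hzw⟩ := hw'
      exact ⟨z, mem_Dslit_of_im_pos hz, hzw⟩

theorem g_im_neg {z : ℂ} (hz : z.im < 0) : (g z).im < 0 := by
  have := g_im_pos (z := starRingEnd ℂ z) (by simpa using hz)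
  rw [g_conj (mem_Dslit_of_im_ne_zero hz.ne)] at this
  simpa using this

theorem g_im_eq_zero {z : ℂ} (hz : z ∈ Dslit) (h : z.im = 0) : (g z).im = 0 := by
  obtain ⟨x, rfl⟩ := exists_ofReal_eq h
  exact g_ofReal_im (mem_Dslit_iff_of_im_eq_zero.1 hz)

theorem sign_g_im {z : ℂ} (hz : z ∈ Dslit) : SignType.sign (g z).im = SignType.sign z.im := by
  rcases lt_trichotomy z.im 0 with h | h | h
  · rw [sign_neg h, sign_neg (g_im_neg h)]
  · rw [h, g_im_eq_zero hz h]
  · rw [sign_pos h, sign_pos (g_im_pos h)]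

theorem injOn_g : InjOn g Dslit := by
  intro z hz w hw h
  have hs : SignType.sign z.im = SignType.sign w.im := by
    rw [← sign_g_im hz, ← sign_g_im hw, h]
  rcases lt_trichotomy z.im 0 with h1 | h1 | h1
  · have h2 : w.im < 0 := by rwa [sign_neg h1, eq_comm, sign_eq_neg_one_iff] at hs
    have hc : g (starRingEnd ℂ z) = g (starRingEnd ℂ w) := by rw [g_conj hz, g_conj hw, h]
    exact (starRingEnd ℂ).injective
      (injOn_g_upperHalf (by simpa using h1) (by simpa using h2) hc)
  · have h2 : w.im = 0 := by rwa [h1, sign_zero, eq_comm, sign_eq_zero_iff] at hs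
    obtain ⟨x, rfl⟩ := exists_ofReal_eq h1
    obtain ⟨y, rfl⟩ := exists_ofReal_eq h2
    rw [strictMonoOn_g_re.injOn (mem_Dslit_iff_of_im_eq_zero.1 hz)
      (mem_Dslit_iff_of_im_eq_zero.1 hw) (congrArg re h)]
  · have h2 : 0 < w.im := by rwa [sign_pos h1, eq_comm, sign_eq_one_iff] at hs
    exact injOn_g_upperHalf h1 h2 h

theorem stmt_1 :
    DifferentiableOn ℂ g Dslit ∧
    Set.InjOn g Dslit ∧
    g '' Dslit = rhombus ∧
    g 0 = 0 ∧
    (∀ x : ℝ, x ∈ Set.Ioo (-1 : ℝ) 1 → (g x).im = 0) ∧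
    StrictMonoOn (fun x : ℝ => (g x).re) (Set.Ioo (-1 : ℝ) 1) ∧
    (fun x : ℝ => (g x).re) '' Set.Ioo (-1 : ℝ) 1 = Set.Ioo (-1 : ℝ) 1 ∧
    Filter.Tendsto g (nhdsWithin 1 Dslit) (nhds 1) ∧
    Filter.Tendsto g (nhdsWithin (-1) Dslit) (nhds (-1)) := by
  exact ⟨fun z hz => (hasDerivAt_g hz).differentiableAt.differentiableWithinAt, injOn_g, image_g,
    g_zero, fun _ => g_ofReal_im, strictMonoOn_g_re, image_g_re, tendsto_g_one, tendsto_g_neg_one⟩
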